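/- Let p be an odd prime, let n ≥ 0 be an integer, and let q, w ∈ ℚ_p with ‖q - 1‖_p < 1, q ≠ 1, and ‖w - 1‖_p < 1. Then the sequence N ↦ ((1+q)/(1+q^{p^N})) · ∑_{x=0}^{p^N - 1} (-1)^x w^x [x]_q^n converges in ℚ_p, as N → ∞, to (1/(1-q)^n) · ∑_{l=0}^n C(n,l)(-1)^l (1+q)/(1+w q^l). (Note that ‖w q^l - 1‖_p < 1, so 1 + w q^l ≠ 0 since p is odd; this is Witt's formula E_{n,w,q}^{(1)} = ∫_{ℤ_p} w^x q^{-x} [x]_q^n dμ_{-q}(x) for the w-q-Euler numbers.) -/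

import Mathlib

open Filter Topology

/-- A principal unit of `ℚ_[p]` tends to `1` under iterated `p`-th powers. -/
lemma Padic.tendsto_pow_prime_pow {p : ℕ} [Fact p.Prime] {u : ℚ_[p]} (hu : ‖u - 1‖ < 1) :
    Tendsto (fun N : ℕ => u ^ p ^ N) atTop (𝓝 1) := by
  have hu1 : ‖u‖ ≤ 1 := by
    calc ‖u‖ = ‖(u - 1) + 1‖ := by rw [sub_add_cancel]
      _ ≤ max ‖u - 1‖ ‖(1 : ℚ_[p])‖ := Padic.nonarchimedean _ _
      _ ≤ 1 := max_le hu.le norm_one.le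
  let v : ℤ_[p] := ⟨u, hu1⟩
  have hdvd : (p : ℤ_[p]) ∣ v - 1 := PadicInt.norm_lt_one_iff_dvd _ |>.1 hu
  have hp1 : (1 : ℝ) < p := by exact_mod_cast (Fact.out : p.Prime).one_lt
  have hbound (N : ℕ) : ‖u ^ p ^ N - 1‖ ≤ ((p : ℝ)⁻¹) ^ (N + 1) := by
    have h := dvd_sub_pow_of_dvd_sub hdvd N
    rw [one_pow, ← Ideal.mem_span_singleton, ← PadicInt.norm_le_pow_iff_mem_span_pow] at h
    rw [inv_pow, ← zpow_natCast (p : ℝ), ← zpow_neg]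
    exact h
  rw [tendsto_iff_norm_sub_tendsto_zero]
  refine squeeze_zero (fun _ => norm_nonneg _) hbound ?_
  exact (tendsto_pow_atTop_nhds_zero_of_lt_one (by positivity) (inv_lt_one_of_one_lt₀ hp1)).comp
    (tendsto_add_atTop_nat 1)

lemma Padic.one_add_ne_zero {p : ℕ} [Fact p.Prime] (hodd : p ≠ 2) {u : ℚ_[p]}
    (hu : ‖u - 1‖ < 1) : 1 + u ≠ 0 := by
  intro h
  have h2 : u - 1 = ((-2 : ℤ) : ℚ_[p]) := by
    push_cast
    linear_combination h
  rw [h2, Padic.norm_intCast_lt_one_iff, dvd_neg] at hu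
  exact hodd ((Nat.prime_dvd_prime_iff_eq Fact.out Nat.prime_two).1 (by exact_mod_cast hu))

lemma Padic.norm_mul_sub_one_lt_one {p : ℕ} [Fact p.Prime] {u v : ℚ_[p]}
    (hu : ‖u - 1‖ < 1) (hv : ‖v - 1‖ < 1) : ‖u * v - 1‖ < 1 := by
  have h : u * v - 1 = (u - 1) * (v - 1) + ((u - 1) + (v - 1)) := by ring
  rw [h]
  refine (Padic.nonarchimedean _ _).trans_lt (max_lt ?_ ?_)
  · rw [norm_mul]
    exact mul_lt_one_of_nonneg_of_lt_one_left (norm_nonneg _) hu hv.le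
  · exact (Padic.nonarchimedean _ _).trans_lt (max_lt hu hv)

lemma Padic.norm_pow_sub_one_lt_one {p : ℕ} [Fact p.Prime] {u : ℚ_[p]}
    (hu : ‖u - 1‖ < 1) (l : ℕ) : ‖u ^ l - 1‖ < 1 := by
  induction l with
  | zero => simp
  | succ l ih => exact pow_succ u l ▸ Padic.norm_mul_sub_one_lt_one ih hu

lemma sum_range_neg_pow_of_odd {K : Type*} [Field K] {u : K} (hu : 1 + u ≠ 0) {m : ℕ}
    (hm : Odd m) : ∑ x ∈ Finset.range m, (-u) ^ x = (1 + u ^ m) / (1 + u) := by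
  rw [eq_div_iff hu]
  linear_combination -geom_sum_mul (-u) m - hm.neg_pow u

lemma sum_range_neg_one_pow_mul_pow_mul_qNumber_pow {K : Type*} [Field K] (q w : K) (n : ℕ)
    {m : ℕ} (hm : Odd m) (hu : ∀ l, 1 + w * q ^ l ≠ 0) :
    ∑ x ∈ Finset.range m, (-1) ^ x * w ^ x * ((1 - q ^ x) / (1 - q)) ^ n =
      (1 / (1 - q) ^ n) * ∑ l ∈ Finset.range (n + 1),
        (n.choose l : K) * (-1) ^ l * ((1 + (w * q ^ l) ^ m) / (1 + w * q ^ l)) := by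
  simp_rw [← fun l => sum_range_neg_pow_of_odd (hu l) hm, Finset.mul_sum]
  rw [Finset.sum_comm]
  refine Finset.sum_congr rfl fun x _ => ?_
  rw [div_pow, sub_eq_neg_add, add_pow, Finset.sum_div, Finset.mul_sum]
  refine Finset.sum_congr rfl fun l _ => ?_
  rw [neg_pow (q ^ x), neg_pow (w * q ^ l), one_pow]
  ring

/-- Let `p` be an odd prime, `n ≥ 0`, and `q, w ∈ ℚ_p` with
`‖q-1‖_p < 1`, `q ≠ 1`, `‖w-1‖_p < 1`. Then
`((1+q)/(1+q^{p^N})) ∑_{x=0}^{p^N-1} (-1)^x w^x [x]_q^n` converges, as `N → ∞`, to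
`(1/(1-q)^n) ∑_{l=0}^n C(n,l)(-1)^l (1+q)/(1+w q^l)`, where `[x]_q = (1-q^x)/(1-q)`. -/
theorem stmt_12 (p : ℕ) [hp : Fact p.Prime] (hodd : p ≠ 2) (n : ℕ)
    (q w : ℚ_[p]) (hq : ‖q - 1‖ < 1) (hq1 : q ≠ 1) (hw : ‖w - 1‖ < 1) :
    Filter.Tendsto (fun N : ℕ =>
      ((1 + q) / (1 + q ^ (p ^ N))) *
        ∑ x ∈ Finset.range (p ^ N),
          (-1 : ℚ_[p]) ^ x * w ^ x * ((1 - q ^ x) / (1 - q)) ^ n)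
      Filter.atTop
      (nhds ((1 / (1 - q) ^ n) * ∑ l ∈ Finset.range (n + 1),
        (n.choose l : ℚ_[p]) * (-1) ^ l * ((1 + q) / (1 + w * q ^ l)))) := by
  have hu (l : ℕ) : ‖w * q ^ l - 1‖ < 1 :=
    Padic.norm_mul_sub_one_lt_one hw (Padic.norm_pow_sub_one_lt_one hq l)
  have hne (l : ℕ) : 1 + w * q ^ l ≠ 0 := Padic.one_add_ne_zero hodd (hu l)
  have h2 : (1 + 1 : ℚ_[p]) ≠ 0 := Padic.one_add_ne_zero hodd (by simp)
  simp_rw [fun N : ℕ => sum_range_neg_one_pow_mul_pow_mul_qNumber_pow q w n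
    ((hp.out.odd_of_ne_two hodd).pow (n := N)) hne]
  have hfactor : Tendsto (fun N : ℕ => (1 + q) / (1 + q ^ p ^ N)) atTop (𝓝 ((1 + q) / (1 + 1))) :=
    tendsto_const_nhds.div ((Padic.tendsto_pow_prime_pow hq).const_add 1) h2
  have hsum := tendsto_finsetSum (Finset.range (n + 1)) fun l _ =>
    (((Padic.tendsto_pow_prime_pow (hu l)).const_add 1).div_const (1 + w * q ^ l)).const_mul
      ((n.choose l : ℚ_[p]) * (-1) ^ l)
  convert hfactor.mul (hsum.const_mul (1 / (1 - q) ^ n)) using 2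
  rw [mul_left_comm, Finset.mul_sum _ _ ((1 + q) / (1 + 1))]
  congr 1
  refine Finset.sum_congr rfl fun l _ => ?_
  have := hne l
  field_simp
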